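/- arXiv:1704.00773 — 2 statements merged into one kernel-verified Lean document; each statement's English description precedes it below -/
import Mathlib

section
/- Let T be a finite set of actions, and for each τ ∈ T let r̄(τ) ∈ ℝ, V_r(τ) > 0, π_test(τ) > 0, and k_τ a positive integer. Define, for ω : T → ℝ, MSE(ω) = (Σ_{τ∈T} (ω(τ) − 1) π_test(τ) r̄(τ))² + Σ_{τ∈T} ω(τ)² π_test(τ)² V_r(τ)/k_τ. Then MSE is minimized over all ω : T → ℝ by the weights ω*(τ) = (k_τ r̄(τ))/(π_test(τ) V_r(τ)) · (Σ_{τ'∈T} π_test(τ') r̄(τ')) / (1 + Σ_{τ'∈T} k_{τ'} r̄(τ')²/V_r(τ')), i.e. MSE(ω*) ≤ MSE(ω) for every ω : T → ℝ. -/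
open Finset

/-- Optimal weights with one behavior policy: the weights
`ω*(τ) = (k_τ r̄(τ))/(π_test(τ) V_r(τ)) · (Σ π_test r̄) / (1 + Σ k r̄²/V_r)`
minimize the MSE `ω ↦ (Σ (ω(τ)−1) π_test(τ) r̄(τ))² + Σ ω(τ)² π_test(τ)² V_r(τ)/k_τ`
over all weight functions `ω : T → ℝ`. -/
theorem optimal_weights_single_policy
    {T : Type*} [Fintype T]
    (rbar Vr πtest : T → ℝ) (k : T → ℕ)
    (hVr : ∀ t, 0 < Vr t) (hπtest : ∀ t, 0 < πtest t) (hk : ∀ t, 0 < k t)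
    (ωopt : T → ℝ)
    (hωopt : ∀ t, ωopt t =
      (k t * rbar t) / (πtest t * Vr t) *
        ((∑ t', πtest t' * rbar t') / (1 + ∑ t', k t' * rbar t' ^ 2 / Vr t'))) :
    ∀ ω : T → ℝ,
      (∑ t, (ωopt t - 1) * πtest t * rbar t) ^ 2
          + ∑ t, ωopt t ^ 2 * πtest t ^ 2 * (Vr t / k t)
        ≤ (∑ t, (ω t - 1) * πtest t * rbar t) ^ 2
          + ∑ t, ω t ^ 2 * πtest t ^ 2 * (Vr t / k t) := by
  intro ω
  have hk_pos : ∀ t, (0 : ℝ) < k t := fun t => by exact_mod_cast hk t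
  set J := ∑ t, πtest t * rbar t
  set S := ∑ t, k t * rbar t ^ 2 / Vr t with hS
  have hS_nonneg : 0 ≤ S :=
    sum_nonneg fun t _ => div_nonneg (mul_nonneg (hk_pos t).le (sq_nonneg _)) (hVr t).le
  set c := J / (1 + S)
  have hJ : J = c * (1 + S) := (div_mul_cancel₀ J (by positivity)).symm
  have h_bias : ∀ w : T → ℝ,
      ∑ t, (w t - 1) * πtest t * rbar t = ∑ t, w t * πtest t * rbar t - J := fun w => by
    rw [← sum_sub_distrib]
    exact sum_congr rfl fun t _ => by ring
  have h_opt_mean : ∑ t, ωopt t * πtest t * rbar t = c * S := by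
    rw [hS, mul_sum]
    refine sum_congr rfl fun t _ => ?_
    have := (hVr t).ne'
    have := (hπtest t).ne'
    rw [hωopt t]
    field_simp
  have h_opt_var : ∑ t, ωopt t ^ 2 * πtest t ^ 2 * (Vr t / k t) = c ^ 2 * S := by
    rw [hS, mul_sum]
    refine sum_congr rfl fun t _ => ?_
    have := (hVr t).ne'
    have := (hπtest t).ne'
    have := (hk_pos t).ne'
    rw [hωopt t]
    field_simp
  have h_var : 2 * c * ∑ t, ω t * πtest t * rbar t - c ^ 2 * S
      ≤ ∑ t, ω t ^ 2 * πtest t ^ 2 * (Vr t / k t) := by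
    rw [hS, mul_sum, mul_sum, ← sum_sub_distrib]
    refine sum_le_sum fun t _ => ?_
    have hV := hVr t
    have hκ := hk_pos t
    have h_sq : 0 ≤ Vr t / k t * (ω t * πtest t - c * (k t * rbar t / Vr t)) ^ 2 := by
      positivity
    have h_expand : Vr t / k t * (ω t * πtest t - c * (k t * rbar t / Vr t)) ^ 2
        = ω t ^ 2 * πtest t ^ 2 * (Vr t / k t)
          - (2 * c * (ω t * πtest t * rbar t) - c ^ 2 * (k t * rbar t ^ 2 / Vr t)) := by
      field_simp
      ring
    linarith
  rw [h_bias, h_bias, h_opt_mean, h_opt_var]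
  rw [hJ]
  nlinarith [sq_nonneg (∑ t, ω t * πtest t * rbar t - c * S)]
end

section
/- The series Σ_{k=0}^∞ (1/2)^{k+1} · k/(k+1) converges and its sum equals 1 − ln 2. -/
theorem hasSum_half_pow_succ_mul_div_succ :
    HasSum (fun k : ℕ => (1 / 2 : ℝ) ^ (k + 1) * (k / (k + 1))) (1 - Real.log 2) := by
  have hlog : HasSum (fun k : ℕ => (1 / 2 : ℝ) ^ (k + 1) / (k + 1)) (Real.log 2) := by
    convert Real.hasSum_pow_div_log_of_abs_lt_one (x := 1 / 2) (by norm_num [abs_of_pos]) using 1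
    rw [← Real.log_inv]
    norm_num
  have hgeom : HasSum (fun k : ℕ => (1 / 2 : ℝ) ^ (k + 1)) 1 := by
    simpa [pow_succ] using hasSum_geometric_two.mul_right (1 / 2 : ℝ)
  have hterm (k : ℕ) : (1 / 2 : ℝ) ^ (k + 1) * (k / (k + 1)) =
      (1 / 2) ^ (k + 1) - (1 / 2) ^ (k + 1) / (k + 1) := by
    have hk : (k : ℝ) + 1 ≠ 0 := Nat.cast_add_one_ne_zero k
    field_simp
    ring
  simpa only [hterm] using hgeom.sub hlog

/-- The expectation of the Empirical Average estimator when sampling stops at the first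
Bernoulli(1/2) reward equal to 0: the series `Σ_{k=0}^∞ (1/2)^{k+1} · k/(k+1)` converges
and its sum equals `1 − ln 2`. -/
theorem empirical_average_bias_series :
    Summable (fun k : ℕ => (1 / 2 : ℝ) ^ (k + 1) * (k / (k + 1))) ∧
    ∑' k : ℕ, (1 / 2 : ℝ) ^ (k + 1) * (k / (k + 1)) = 1 - Real.log 2 :=
  ⟨hasSum_half_pow_succ_mul_div_succ.summable, hasSum_half_pow_succ_mul_div_succ.tsum_eq⟩
end
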